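/- arXiv:2604.18350 — 2 statements merged into one kernel-verified Lean document; each statement's English description precedes it below -/
import Mathlib

section
/- Write the n-th Chebyshev polynomial of the first kind as T_n(x) = Σ_{j=0}^{n} a_{j,n} x^j. Then for all natural numbers n and all 0 ≤ j ≤ n, the coefficients satisfy |a_{j,n}| ≤ 2^j · C(n,j), where C(n,j) is the binomial coefficient. -/
/-- The coefficient bound holds without restricting `j`: both sides vanish when `n < j`. -/
theorem Polynomial.Chebyshev.abs_coeff_T_le (n j : ℕ) :
    |(Polynomial.Chebyshev.T ℝ (n : ℤ)).coeff j| ≤ 2 ^ j * (n.choose j : ℝ) := by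
  induction n using Nat.twoStepInduction generalizing j with
  | zero => rcases j with _ | j <;> simp [Polynomial.coeff_one]
  | one => rcases j with _ | _ | j <;> simp [Polynomial.coeff_X]
  | more n ih₀ ih₁ =>
    have hT : T ℝ ((n + 2 : ℕ) : ℤ) =
        Polynomial.C 2 * (Polynomial.X * T ℝ ((n + 1 : ℕ) : ℤ)) - T ℝ (n : ℤ) := by
      push_cast
      rw [T_add_two, ← mul_assoc]
      rfl
    rw [hT, Polynomial.coeff_sub, Polynomial.coeff_C_mul]
    rcases j with _ | j
    · simpa using ih₀ 0
    · rw [Polynomial.coeff_X_mul]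
      have hmono : (n.choose (j + 1) : ℝ) ≤ ((n + 1).choose (j + 1) : ℝ) :=
        mod_cast Nat.choose_le_choose (j + 1) n.le_succ
      calc |2 * (T ℝ ((n + 1 : ℕ) : ℤ)).coeff j - (T ℝ (n : ℤ)).coeff (j + 1)|
          ≤ 2 * |(T ℝ ((n + 1 : ℕ) : ℤ)).coeff j| + |(T ℝ (n : ℤ)).coeff (j + 1)| := by
            refine (abs_sub _ _).trans_eq ?_
            rw [abs_mul, abs_two]
        _ ≤ 2 * (2 ^ j * ((n + 1).choose j : ℝ)) + 2 ^ (j + 1) * (n.choose (j + 1) : ℝ) := by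
            gcongr
            · exact ih₁ j
            · exact ih₀ (j + 1)
        _ ≤ 2 * (2 ^ j * ((n + 1).choose j : ℝ)) +
              2 ^ (j + 1) * ((n + 1).choose (j + 1) : ℝ) := by gcongr
        _ = 2 ^ (j + 1) * ((n + 2).choose (j + 1) : ℝ) := by
            rw [Nat.choose_succ_succ' (n + 1) j]
            push_cast
            ring

/-- The coefficients `a_{j,n}` of the Chebyshev polynomial of the first kind
`T_n(x) = Σ_{j=0}^n a_{j,n} x^j` satisfy `|a_{j,n}| ≤ 2^j · C(n,j)`. -/
theorem chebyshev_coeff_bound (n j : ℕ) (hjn : j ≤ n) :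
    |(Polynomial.Chebyshev.T ℝ (n : ℤ)).coeff j| ≤ 2 ^ j * (n.choose j : ℝ) :=
  Polynomial.Chebyshev.abs_coeff_T_le n j
end

section
/- Let P and Q be real polynomial functions on ℝ² and let 0 < r₁ < r₂ be real numbers such that |Q(z)| < |P(z)| for every z ∈ ℝ² with ‖z‖ = r₁ or ‖z‖ = r₂. Then for every (α,β) ∈ ℝ² with α²+β² = 1, the number of roots, counted with multiplicity, of the univariate real polynomial s ↦ P(αs,βs) lying in the open interval (r₁,r₂) is congruent modulo 2 to the number of roots, counted with multiplicity, of s ↦ P(αs,βs)+Q(αs,βs) lying in (r₁,r₂). (Both univariate polynomials are nonzero since they do not vanish at s = r₁.) -/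
/-- The number of roots, counted with multiplicity, of a univariate real polynomial in the
open interval `(r₁, r₂)`. -/
noncomputable def rootCountIoo (p : Polynomial ℝ) (r₁ r₂ : ℝ) : ℕ :=
  Multiset.card (p.roots.filter (fun x => r₁ < x ∧ x < r₂))

theorem rootCountIoo_X_sub_C_mul {q : Polynomial ℝ} (hq : q ≠ 0) {a b c : ℝ}
    (hc : a < c ∧ c < b) :
    rootCountIoo ((Polynomial.X - Polynomial.C c) * q) a b = rootCountIoo q a b + 1 := by
  unfold rootCountIoo
  rw [Polynomial.roots_mul (mul_ne_zero (Polynomial.X_sub_C_ne_zero c) hq),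
    Polynomial.roots_X_sub_C, Multiset.singleton_add,
    Multiset.filter_cons_of_pos (p := fun x => a < x ∧ x < b) _ hc, Multiset.card_cons]

theorem rootCountIoo_eq_zero_iff {p : Polynomial ℝ} (hp : p ≠ 0) {a b : ℝ} :
    rootCountIoo p a b = 0 ↔ ∀ c, a < c → c < b → p.eval c ≠ 0 := by
  simp only [rootCountIoo, Multiset.card_eq_zero, Multiset.filter_eq_nil,
    Polynomial.mem_roots hp, Polynomial.IsRoot.def]
  exact ⟨fun h c h₁ h₂ h₃ => h c h₃ ⟨h₁, h₂⟩, fun h c h₃ h' => h c h'.1 h'.2 h₃⟩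

/-- A real polynomial takes values of the same
sign at the ends of an interval iff it has an even number of roots inside. -/
theorem even_rootCountIoo_iff {p : Polynomial ℝ} {a b : ℝ} (hab : a < b)
    (ha : p.eval a ≠ 0) (hb : p.eval b ≠ 0) :
    Even (rootCountIoo p a b) ↔ 0 < p.eval a * p.eval b := by
  induction hn : rootCountIoo p a b generalizing p with
  | zero =>
    have hp : p ≠ 0 := by rintro rfl; simp at ha
    rw [rootCountIoo_eq_zero_iff hp] at hn
    simp only [Even.zero, true_iff]
    by_contra! hneg
    have h0 : (0 : ℝ) ∈ Set.uIcc (p.eval a) (p.eval b) := by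
      rw [Set.mem_uIcc]
      exact (mul_nonpos_iff.mp hneg).symm.imp id And.symm
    obtain ⟨c, hc, hc0⟩ := intermediate_value_uIcc p.continuous.continuousOn h0
    rw [Set.uIcc_of_le hab.le] at hc
    have hca : a ≠ c := by rintro rfl; exact ha hc0
    have hcb : c ≠ b := by rintro rfl; exact hb hc0
    exact hn c (hc.1.lt_of_ne hca) (hc.2.lt_of_ne hcb) hc0
  | succ n ih =>
    have hp : p ≠ 0 := by rintro rfl; simp at ha
    have hne : rootCountIoo p a b ≠ 0 := by omega
    rw [Ne, rootCountIoo_eq_zero_iff hp] at hne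
    push Not at hne
    obtain ⟨c, hac, hcb, hc⟩ := hne
    obtain ⟨q, rfl⟩ := Polynomial.dvd_iff_isRoot.mpr hc
    rw [rootCountIoo_X_sub_C_mul (right_ne_zero_of_mul hp) ⟨hac, hcb⟩] at hn
    simp only [Polynomial.eval_mul, Polynomial.eval_sub, Polynomial.eval_X,
      Polynomial.eval_C] at ha hb ⊢
    have hqa := right_ne_zero_of_mul ha
    have hqb := right_ne_zero_of_mul hb
    have hfac : (a - c) * (b - c) < 0 := mul_neg_of_neg_of_pos (sub_neg.2 hac) (sub_pos.2 hcb)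
    rw [Nat.even_add_one, ih hqa hqb (by omega), mul_mul_mul_comm,
      not_lt, (mul_ne_zero hqa hqb).le_iff_lt]
    simp [mul_pos_iff (a := (a - c) * (b - c)), hfac, hfac.not_gt]

theorem mul_add_pos_of_abs_lt {x y : ℝ} (h : |y| < |x|) : 0 < x * (x + y) := by
  rcases lt_or_ge x 0 with hx | hx
  · rw [abs_of_neg hx, abs_lt] at h
    exact mul_pos_of_neg_of_neg hx (by linarith)
  · rw [abs_of_nonneg hx, abs_lt] at h
    exact mul_pos (by linarith) (by linarith)

/-- A strict perturbation bound at both end points preserves the parity of the root count. -/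
theorem rootCountIoo_add_mod_two {p q : Polynomial ℝ} {a b : ℝ} (hab : a < b)
    (ha : |q.eval a| < |p.eval a|) (hb : |q.eval b| < |p.eval b|) :
    rootCountIoo p a b % 2 = rootCountIoo (p + q) a b % 2 := by
  have hpa := mul_add_pos_of_abs_lt ha
  have hpb := mul_add_pos_of_abs_lt hb
  have hprod : 0 < (p.eval a * p.eval b) * ((p + q).eval a * (p + q).eval b) := by
    rw [mul_mul_mul_comm, Polynomial.eval_add, Polynomial.eval_add]
    exact mul_pos hpa hpb
  have hp := even_rootCountIoo_iff hab (left_ne_zero_of_mul hpa.ne')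
    (left_ne_zero_of_mul hpb.ne')
  have hpq := even_rootCountIoo_iff (p := p + q) hab
    (by simpa using right_ne_zero_of_mul hpa.ne') (by simpa using right_ne_zero_of_mul hpb.ne')
  have hsign := pos_iff_pos_of_mul_pos hprod
  rw [← hp, ← hpq, Nat.even_iff, Nat.even_iff] at hsign
  omega

theorem eval_aeval_line (P : MvPolynomial (Fin 2) ℝ) (α β s : ℝ) :
    (MvPolynomial.aeval ![Polynomial.C α * Polynomial.X,
      Polynomial.C β * Polynomial.X] P).eval s = MvPolynomial.eval ![α * s, β * s] P := by
  induction P using MvPolynomial.induction_on with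
  | C a => simp
  | add p q hp hq => simp [hp, hq]
  | mul_X p i hp => fin_cases i <;> simp [hp]

/-- Barrier parity invariance: if `P, Q` are real polynomial functions on `ℝ²` with
`|Q| < |P|` on the circles `‖z‖ = r₁` and `‖z‖ = r₂` (`0 < r₁ < r₂`), then for every unit
vector `(α,β)`, the number of roots (with multiplicity) of `s ↦ P(αs,βs)` in `(r₁,r₂)` has
the same parity as that of `s ↦ P(αs,βs) + Q(αs,βs)`. -/
theorem barrier_parity_invariance (P Q : MvPolynomial (Fin 2) ℝ) (r₁ r₂ : ℝ)
    (h0 : 0 < r₁) (h12 : r₁ < r₂)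
    (hbound : ∀ z : ℝ × ℝ,
      (Real.sqrt (z.1 ^ 2 + z.2 ^ 2) = r₁ ∨ Real.sqrt (z.1 ^ 2 + z.2 ^ 2) = r₂) →
      |MvPolynomial.eval ![z.1, z.2] Q| < |MvPolynomial.eval ![z.1, z.2] P|)
    (α β : ℝ) (hαβ : α ^ 2 + β ^ 2 = 1) :
    rootCountIoo (MvPolynomial.aeval ![Polynomial.C α * Polynomial.X,
        Polynomial.C β * Polynomial.X] P) r₁ r₂ % 2 =
      rootCountIoo (MvPolynomial.aeval ![Polynomial.C α * Polynomial.X,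
        Polynomial.C β * Polynomial.X] (P + Q)) r₁ r₂ % 2 := by
  have hline : ∀ s, 0 < s → Real.sqrt ((α * s) ^ 2 + (β * s) ^ 2) = s := fun s hs => by
    rw [mul_pow, mul_pow, ← add_mul, hαβ, one_mul, Real.sqrt_sq hs.le]
  rw [map_add]
  apply rootCountIoo_add_mod_two h12
  · simpa only [eval_aeval_line] using hbound (α * r₁, β * r₁) (.inl (hline r₁ h0))
  · simpa only [eval_aeval_line] using
      hbound (α * r₂, β * r₂) (.inr (hline r₂ (h0.trans h12)))
end
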